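/- arXiv:1501.04456 — 9 statements merged into one kernel-verified Lean document; each statement's English description precedes it below -/
import Mathlib

section
/- Let E be a real inner product space and let x, k ∈ E with ‖x‖ = 1, ‖k‖ = 1, k ≠ x and k ≠ -x. Let ẋ ∈ E satisfy ⟨x, ẋ⟩ = 0 and let m ∈ ℝ with m ≥ 0. Set a = ‖x - k‖ (so that 0 < a < 2) and ρ = 2·arcsin(a/2). Then ‖ẋ‖² - (1 - a²/4)⁻¹·⟨k, ẋ⟩²/a² - ρ·(1/a)·(1 - a²/4)^(-1/2)·[ (1/4)·⟨k, ẋ⟩²·(1 - a²/4)⁻¹ - ( m - ‖ẋ‖²·⟨k, x⟩ + ⟨k, ẋ⟩²/a² ) ] ≥ 0. -/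
open scoped RealInnerProductSpace

/-- On `[0, π]` one has `θ cos θ ≤ sin θ`. -/
theorem Real.mul_cos_le_sin {θ : ℝ} (h0 : 0 ≤ θ) (hpi : θ ≤ Real.pi) :
    θ * Real.cos θ ≤ Real.sin θ := by
  rcases lt_or_ge θ (Real.pi / 2) with h | h
  · have hc : 0 < Real.cos θ := Real.cos_pos_of_mem_Ioo ⟨by linarith [Real.pi_pos], h⟩
    have ht := Real.le_tan h0 h
    rwa [Real.tan_eq_sin_div_cos, le_div_iff₀ hc] at ht
  · have hc : Real.cos θ ≤ 0 :=
      Real.cos_nonpos_of_pi_div_two_le_of_le h (by linarith [Real.pi_pos])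
    exact (mul_nonpos_of_nonneg_of_nonpos h0 hc).trans (Real.sin_nonneg_of_nonneg_of_le_pi h0 hpi)

/-- Cauchy–Schwarz for the component of the unit vector `k` orthogonal to the unit vector `x`. -/
theorem real_inner_sq_le_of_inner_eq_zero {E : Type*} [NormedAddCommGroup E]
    [InnerProductSpace ℝ E] {x k v : E} (hx : ‖x‖ = 1) (hk : ‖k‖ = 1) (hv : ⟪x, v⟫ = 0) :
    ⟪k, v⟫ ^ 2 ≤ ‖v‖ ^ 2 * (1 - ⟪k, x⟫ ^ 2) := by
  have h := real_inner_mul_inner_self_le (k - ⟪k, x⟫ • x) v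
  have h1 : ⟪k - ⟪k, x⟫ • x, v⟫ = ⟪k, v⟫ := by
    rw [inner_sub_left, real_inner_smul_left, hv]; ring
  have h2 : ⟪k - ⟪k, x⟫ • x, k - ⟪k, x⟫ • x⟫ = 1 - ⟪k, x⟫ ^ 2 := by
    rw [real_inner_self_eq_norm_sq, norm_sub_sq_real, real_inner_smul_right, norm_smul, hx, hk,
      mul_one, Real.norm_eq_abs, sq_abs]
    ring
  rw [h1, h2, real_inner_self_eq_norm_sq] at h
  linarith

/-- The key pointwise inequality proving smooth self-convexity on the sphere `Sⁿ`.
Here `x` is a point of the unit sphere, `k = K(x)` the closest point in the submanifold,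
`ẋ` a tangent vector at `x`, `m = ⟨DK_x ẋ, ẋ⟩ ≥ 0`, `a = ‖x - k‖`, and
`ρ = 2·arcsin(a/2)` the spherical distance. The displayed quantity is
`‖ẋ‖²·‖Dρ_x‖² - (Dρ_x ẋ)² - ρ(x)·D²ρ_x(ẋ,ẋ)`. -/
theorem sphere_self_convexity_inequality {E : Type*} [NormedAddCommGroup E]
    [InnerProductSpace ℝ E] (x k : E) (hx : ‖x‖ = 1) (hk : ‖k‖ = 1)
    (hkx : k ≠ x) (hkx' : k ≠ -x)
    (v : E) (hv : ⟪x, v⟫ = 0) (m : ℝ) (hm : 0 ≤ m)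
    (a ρ : ℝ) (ha : a = ‖x - k‖) (hρ : ρ = 2 * Real.arcsin (a / 2)) :
    ‖v‖ ^ 2 - (1 - a ^ 2 / 4)⁻¹ * ⟪k, v⟫ ^ 2 / a ^ 2
      - ρ * (1 / a) * (Real.sqrt (1 - a ^ 2 / 4))⁻¹ *
        (1 / 4 * ⟪k, v⟫ ^ 2 * (1 - a ^ 2 / 4)⁻¹
          - (m - ‖v‖ ^ 2 * ⟪k, x⟫ + ⟪k, v⟫ ^ 2 / a ^ 2)) ≥ 0 := by
  have hinner : ⟪k, x⟫ = 1 - a ^ 2 / 2 := by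
    have h := norm_sub_sq_real x k
    rw [← ha, hx, hk, real_inner_comm] at h
    linarith
  have ha0 : 0 < a := by
    rw [ha]; exact norm_pos_iff.mpr (sub_ne_zero.mpr hkx.symm)
  have ha2 : 0 < 1 - a ^ 2 / 4 := by
    have h := norm_add_sq_real k x
    have hpos : 0 < ‖k + x‖ := norm_pos_iff.mpr fun h0 => hkx' (eq_neg_of_add_eq_zero_left h0)
    rw [hk, hx, hinner] at h
    nlinarith
  have hcs := real_inner_sq_le_of_inner_eq_zero hx hk hv
  set t := Real.sqrt (1 - a ^ 2 / 4) with ht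
  have ht0 : 0 < t := Real.sqrt_pos.mpr ha2
  have ht2 : 1 - a ^ 2 / 4 = t ^ 2 := (Real.sq_sqrt ha2.le).symm
  have hsin : Real.sin (Real.arcsin (a / 2)) = a / 2 :=
    Real.sin_arcsin (by linarith) (by nlinarith)
  have hcos : Real.cos (Real.arcsin (a / 2)) = t := by
    rw [Real.cos_arcsin, ht]; congr 1; ring
  have hρ0 : 0 ≤ ρ := by
    rw [hρ]; exact mul_nonneg two_pos.le (Real.arcsin_nonneg.mpr (by linarith))
  have hρpi : ρ ≤ Real.pi := by
    linarith [Real.arcsin_le_pi_div_two (a / 2)]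
  have hkey : ρ * (2 * t ^ 2 - 1) ≤ a * t := by
    have h := Real.mul_cos_le_sin hρ0 hρpi
    have hs : Real.sin ρ = a * t := by rw [hρ, Real.sin_two_mul, hsin, hcos]; ring
    have hc : Real.cos ρ = 2 * t ^ 2 - 1 := by rw [hρ, Real.cos_two_mul, hcos]
    rwa [hs, hc] at h
  have hc : ⟪k, x⟫ = 2 * t ^ 2 - 1 := by rw [hinner]; linarith
  have hdefect : 0 ≤ ‖v‖ ^ 2 * (a * t) ^ 2 - ⟪k, v⟫ ^ 2 := by
    have h : 1 - ⟪k, x⟫ ^ 2 = (a * t) ^ 2 := by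
      rw [hinner, mul_pow, ← ht2]; ring
    rw [h] at hcs
    linarith
  have hrepr : 0 ≤ (‖v‖ ^ 2 * (a * t) ^ 2 - ⟪k, v⟫ ^ 2) * (a * t - ρ * (2 * t ^ 2 - 1))
      / (a * t) ^ 3 + ρ * m / (a * t) := by
    have := sub_nonneg.mpr hkey
    positivity
  rw [ht2, hc]
  refine hrepr.trans_eq ?_
  generalize ⟪k, v⟫ = p
  clear_value t
  field_simp
  linear_combination (-4 * ρ * p ^ 2) * ht2
end

section
/- For every r ∈ (0,1) and all ṙ, φ̇ ∈ ℝ, one has (ṙ² + r²·φ̇²)/(1-r)² - (ṙ/(1-r))² - (-log(1-r))·(r·φ̇²/(1-r)²) = r·φ̇²·(r + log(1-r))/(1-r)². Moreover this quantity is ≤ 0, and it equals 0 if and only if φ̇ = 0 (since r + log(1-r) < 0 for all r ∈ (0,1)). -/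
/-- The key computation for the failure of self-convexity in the hyperbolic plane:
in the disk model with polar coordinates, for `r ∈ (0,1)` and tangent vector `(rdot, phidot)`,
the quantity `‖(ṙ,φ̇)‖²·‖Dρ‖² - (Dρ(ṙ,φ̇))² - ρ·D²ρ((ṙ,φ̇),(ṙ,φ̇))` equals
`r·φ̇²·(r + log(1-r))/(1-r)²`, which is `≤ 0`, with equality iff `φ̇ = 0`,
since `r + log(1-r) < 0` on `(0,1)`. -/
theorem hyperbolic_quantity (r rdot phidot : ℝ) (hr : r ∈ Set.Ioo (0 : ℝ) 1) :
    ((rdot ^ 2 + r ^ 2 * phidot ^ 2) / (1 - r) ^ 2 - (rdot / (1 - r)) ^ 2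
        - (-Real.log (1 - r)) * (r * phidot ^ 2 / (1 - r) ^ 2)
      = r * phidot ^ 2 * (r + Real.log (1 - r)) / (1 - r) ^ 2) ∧
    r * phidot ^ 2 * (r + Real.log (1 - r)) / (1 - r) ^ 2 ≤ 0 ∧
    (r * phidot ^ 2 * (r + Real.log (1 - r)) / (1 - r) ^ 2 = 0 ↔ phidot = 0) ∧
    r + Real.log (1 - r) < 0 := by
  obtain ⟨hr0, hr1⟩ := hr
  have hpos : 0 < 1 - r := sub_pos.mpr hr1
  have hlog : r + Real.log (1 - r) < 0 := by
    linarith [Real.log_lt_sub_one_of_pos hpos (by linarith)]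
  refine ⟨by field_simp; ring, ?_, ?_, hlog⟩
  · exact div_nonpos_of_nonpos_of_nonneg
      (mul_nonpos_of_nonneg_of_nonpos (by positivity) hlog.le) (by positivity)
  · simp [hr0.ne', hpos.ne', hlog.ne]
end

section
/- Let n ≥ 1, let I ⊆ ℝ be an open interval, and let θ₁, ..., θₙ : I → ℝ be twice differentiable functions with θ₁(t) ∈ (0,π) for all t ∈ I. Suppose that for all t ∈ I the first geodesic equation of the condition metric on the punctured sphere holds: θ₁''(t) - θ₁'(t)²/θ₁(t) - ((θ₁(t)·sin θ₁(t)·cos θ₁(t) - sin² θ₁(t))/θ₁(t)) · Σ_{j=2}^{n} ( Π_{r=2}^{j-1} sin² θᵣ(t) ) · θⱼ'(t)² = 0 (where the product over an empty index range equals 1). Then the function t ↦ log θ₁(t) is concave on I. -/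
/-- On `[0, π]`, the inequality `x ≤ tan x` in a form free of denominators. -/
theorem Real.mul_cos_le_sin_of_mem_Icc {x : ℝ} (hx : x ∈ Set.Icc 0 Real.pi) :
    x * Real.cos x ≤ Real.sin x := by
  rcases lt_or_ge x (Real.pi / 2) with h | h
  · have hc : 0 < Real.cos x := Real.cos_pos_of_mem_Ioo ⟨by linarith [hx.1, Real.pi_pos], h⟩
    rw [← le_div_iff₀ hc, ← Real.tan_eq_sin_div_cos]
    exact Real.le_tan hx.1 h
  · have hc : Real.cos x ≤ 0 :=
      Real.cos_nonpos_of_pi_div_two_le_of_le h (by linarith [hx.2, Real.pi_pos])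
    exact (mul_nonpos_of_nonneg_of_nonpos hx.1 hc).trans (Real.sin_nonneg_of_mem_Icc hx)


open Real in
/-- Proposition 8 of the paper (smooth self-convexity for `M = Sⁿ`, `N` the north pole):
if `θ₁, ..., θₙ : I → ℝ` are twice differentiable with `θ₁(t) ∈ (0,π)` and satisfy the
first geodesic equation of the condition metric on the punctured sphere, then
`t ↦ log θ₁(t)` is concave on `I`. The product over an empty index range equals `1`. -/
theorem punctured_sphere_self_convexity (n : ℕ) (hn : 1 ≤ n) (a b : ℝ)
    (θ : ℕ → ℝ → ℝ)
    (hdiff : ∀ i ∈ Finset.Icc 1 n, ∀ t ∈ Set.Ioo a b, DifferentiableAt ℝ (θ i) t)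
    (hdiff' : ∀ i ∈ Finset.Icc 1 n, ∀ t ∈ Set.Ioo a b, DifferentiableAt ℝ (deriv (θ i)) t)
    (hrange : ∀ t ∈ Set.Ioo a b, θ 1 t ∈ Set.Ioo 0 π)
    (hgeo : ∀ t ∈ Set.Ioo a b,
      deriv (deriv (θ 1)) t - (deriv (θ 1) t) ^ 2 / θ 1 t
        - ((θ 1 t * sin (θ 1 t) * cos (θ 1 t) - sin (θ 1 t) ^ 2) / θ 1 t) *
            ∑ j ∈ Finset.Icc 2 n,
              (∏ r ∈ Finset.Icc 2 (j - 1), sin (θ r t) ^ 2) * (deriv (θ j) t) ^ 2 = 0) :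
    ConcaveOn ℝ (Set.Ioo a b) (fun t => log (θ 1 t)) := by
  have h1 : 1 ∈ Finset.Icc 1 n := Finset.mem_Icc.2 ⟨le_rfl, hn⟩
  refine concaveOn_of_hasDerivWithinAt2_nonpos (convex_Ioo a b)
    (f' := fun t => deriv (θ 1) t / θ 1 t)
    (f'' := fun t => (deriv (deriv (θ 1)) t * θ 1 t - deriv (θ 1) t * deriv (θ 1) t) / θ 1 t ^ 2)
    (fun t ht => ((hdiff 1 h1 t ht).continuousAt.log (hrange t ht).1.ne').continuousWithinAt)
    ?_ ?_ ?_ <;> rw [interior_Ioo] <;> intro t ht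
  · exact ((hdiff 1 h1 t ht).hasDerivAt.log (hrange t ht).1.ne').hasDerivWithinAt
  · exact ((hdiff' 1 h1 t ht).hasDerivAt.div (hdiff 1 h1 t ht).hasDerivAt
      (hrange t ht).1.ne').hasDerivWithinAt
  · obtain ⟨hpos, hpi⟩ := hrange t ht
    have hcoef : (θ 1 t * sin (θ 1 t) * cos (θ 1 t) - sin (θ 1 t) ^ 2) / θ 1 t ≤ 0 := by
      refine div_nonpos_of_nonpos_of_nonneg ?_ hpos.le
      have := mul_le_mul_of_nonneg_left (Real.mul_cos_le_sin_of_mem_Icc ⟨hpos.le, hpi.le⟩)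
        (sin_pos_of_pos_of_lt_pi hpos hpi).le
      linarith
    have hsum : 0 ≤ ∑ j ∈ Finset.Icc 2 n,
        (∏ r ∈ Finset.Icc 2 (j - 1), sin (θ r t) ^ 2) * (deriv (θ j) t) ^ 2 :=
      Finset.sum_nonneg fun j _ =>
        mul_nonneg (Finset.prod_nonneg fun r _ => sq_nonneg _) (sq_nonneg _)
    have hle : deriv (deriv (θ 1)) t ≤ (deriv (θ 1) t) ^ 2 / θ 1 t := by
      linarith [hgeo t ht, mul_nonpos_of_nonpos_of_nonneg hcoef hsum]
    rw [le_div_iff₀ hpos] at hle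
    exact div_nonpos_of_nonpos_of_nonneg (by linarith) (sq_nonneg _)
end

section
/- Let E be a real inner product space, let N ⊆ E be a subset, let U ⊆ E be an open set, and let K : U → E be a continuously differentiable map such that for every z ∈ U: K(z) ∈ N, ‖z - K(z)‖ ≤ ‖z - y‖ for every y ∈ N, and ⟨z - K(z), DK_z v⟩ = 0 for every v ∈ E (where DK_z denotes the Fréchet derivative of K at z). Then for every x ∈ U and every ẋ ∈ E, one has ⟨DK_x ẋ, ẋ⟩ ≥ 0. -/
open scoped RealInnerProductSpace

/-- If `p` is at least as close to `z` as `q`, and `q` is at least as close to `w` as `p`, then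
`p - q` and `z - w` have nonnegative inner product. -/
theorem inner_sub_sub_nonneg_of_norm_sub_le {E : Type*} [NormedAddCommGroup E]
    [InnerProductSpace ℝ E] {z w p q : E} (hz : ‖z - p‖ ≤ ‖z - q‖) (hw : ‖w - q‖ ≤ ‖w - p‖) :
    0 ≤ ⟪p - q, z - w⟫ := by
  have hz2 := pow_le_pow_left₀ (norm_nonneg _) hz 2
  have hw2 := pow_le_pow_left₀ (norm_nonneg _) hw 2
  simp only [norm_sub_sq_real] at hz2 hw2
  rw [real_inner_comm]
  simp only [inner_sub_left, inner_sub_right]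
  linarith

/-- The derivative of a map that is monotone with respect to a base point, locally near that
point, is positive semidefinite there. -/
theorem HasFDerivAt.inner_self_nonneg_of_eventually {E : Type*} [NormedAddCommGroup E]
    [InnerProductSpace ℝ E] {f : E → E} {f' : E →L[ℝ] E} {x : E} (hf : HasFDerivAt f f' x)
    (hmono : ∀ᶠ z in nhds x, 0 ≤ ⟪f z - f x, z - x⟫) (v : E) : 0 ≤ ⟪f' v, v⟫ := by
  have hlim := ((hf.hasLineDerivAt v).tendsto_slope_zero_right).inner (𝕜 := ℝ)
    (tendsto_const_nhds (x := v))
  have hpath : Filter.Tendsto (fun t : ℝ => x + t • v) (nhdsWithin 0 (Set.Ioi 0)) (nhds x) := by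
    have hcont : Continuous fun t : ℝ => x + t • v := by fun_prop
    simpa using (hcont.tendsto 0).mono_left nhdsWithin_le_nhds
  refine ge_of_tendsto hlim ?_
  filter_upwards [hpath.eventually hmono, self_mem_nhdsWithin] with t ht htpos
  have htpos : 0 < t := htpos
  rw [add_sub_cancel_left, inner_smul_right] at ht
  rw [real_inner_smul_left]
  exact mul_nonneg (inv_nonneg.2 htpos.le) (nonneg_of_mul_nonneg_right ht htpos)

/-- Lemma 12 of the paper: monotonicity of the nearest-point map. If `K : U → E` is a `C¹`
nearest-point map onto `N` (with the first-order orthogonality condition at the closest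
point), then `⟨DK_x ẋ, ẋ⟩ ≥ 0` for every `x ∈ U` and `ẋ ∈ E`. -/
theorem nearest_point_map_monotone {E : Type*} [NormedAddCommGroup E]
    [InnerProductSpace ℝ E] (N U : Set E) (hU : IsOpen U) (K : E → E)
    (hK : ContDiffOn ℝ 1 K U)
    (hKN : ∀ z ∈ U, K z ∈ N)
    (hKmin : ∀ z ∈ U, ∀ y ∈ N, ‖z - K z‖ ≤ ‖z - y‖)
    (horth : ∀ z ∈ U, ∀ v : E, ⟪z - K z, fderiv ℝ K z v⟫ = 0)
    (x : E) (hx : x ∈ U) (v : E) :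
    0 ≤ ⟪fderiv ℝ K x v, v⟫ := by
  have hdiff : DifferentiableAt ℝ K x :=
    (hK.contDiffAt (hU.mem_nhds hx)).differentiableAt one_ne_zero
  refine hdiff.hasFDerivAt.inner_self_nonneg_of_eventually ?_ v
  filter_upwards [hU.mem_nhds hx] with z hz
  exact inner_sub_sub_nonneg_of_norm_sub_le (hKmin z hz _ (hKN x hx)) (hKmin x hx _ (hKN z hz))
end

section
/- Let E be a real inner product space, let t₀ ∈ ℝ, and let c, k : ℝ → E be curves, both differentiable at t₀, such that ‖c(t)‖ = 1 for all t in a neighborhood of t₀, ⟨c(t₀) - k(t₀), k'(t₀)⟩ = 0, and 0 < ‖c(t₀) - k(t₀)‖ < 2. Then the function t ↦ 2·arcsin(‖c(t) - k(t)‖/2) is differentiable at t₀ with derivative equal to -(1 - ‖c(t₀) - k(t₀)‖²/4)^(-1/2) · ⟨k(t₀), c'(t₀)⟩ / ‖c(t₀) - k(t₀)‖. -/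
open scoped RealInnerProductSpace

theorem HasDerivAt.norm_of_ne_zero {F : Type*} [NormedAddCommGroup F] [InnerProductSpace ℝ F]
    {f : ℝ → F} {f' : F} {x : ℝ} (hf : HasDerivAt f f' x) (hx : f x ≠ 0) :
    HasDerivAt (fun t => ‖f t‖) (⟪f x, f'⟫ / ‖f x‖) x := by
  have h : HasDerivAt (fun t => ‖f t‖ ^ 2) (2 * ⟪f x, f'⟫) x := hf.norm_sq
  have hs := h.sqrt (pow_ne_zero 2 (norm_ne_zero_iff.mpr hx))
  simp only [Real.sqrt_sq (norm_nonneg _)] at hs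
  rwa [mul_div_mul_left _ _ two_ne_zero] at hs

theorem HasDerivAt.inner_eq_zero_of_norm_eventually_eq {F : Type*} [NormedAddCommGroup F]
    [InnerProductSpace ℝ F] {f : ℝ → F} {f' : F} {x r : ℝ} (hf : HasDerivAt f f' x)
    (hr : ∀ᶠ t in nhds x, ‖f t‖ = r) : ⟪f x, f'⟫ = 0 := by
  have h : HasDerivAt (fun t => ‖f t‖ ^ 2) (2 * ⟪f x, f'⟫) x := hf.norm_sq
  have hconst : HasDerivAt (fun t => ‖f t‖ ^ 2) 0 x :=
    (hasDerivAt_const x (r ^ 2)).congr_of_eventuallyEq (hr.mono fun t ht => by simp [ht])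
  simpa using h.unique hconst

/-- Lemma 10 of the paper (first derivative of the spherical distance): if `c` is a curve
on the unit sphere and `k` is the curve of closest points, both differentiable at `t₀`,
with `⟨c(t₀) - k(t₀), k'(t₀)⟩ = 0` and `0 < ‖c(t₀) - k(t₀)‖ < 2`, then
`t ↦ 2·arcsin(‖c(t) - k(t)‖/2)` is differentiable at `t₀` with derivative
`-(1 - ‖c(t₀)-k(t₀)‖²/4)^(-1/2)·⟨k(t₀), c'(t₀)⟩/‖c(t₀)-k(t₀)‖`. -/
theorem deriv_spherical_distance {E : Type*} [NormedAddCommGroup E]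
    [InnerProductSpace ℝ E] (t₀ : ℝ) (c k : ℝ → E) (c' k' : E)
    (hc : HasDerivAt c c' t₀) (hk : HasDerivAt k k' t₀)
    (hnorm : ∀ᶠ t in nhds t₀, ‖c t‖ = 1)
    (horth : ⟪c t₀ - k t₀, k'⟫ = 0)
    (h0 : 0 < ‖c t₀ - k t₀‖) (h2 : ‖c t₀ - k t₀‖ < 2) :
    HasDerivAt (fun t => 2 * Real.arcsin (‖c t - k t‖ / 2))
      (-(Real.sqrt (1 - ‖c t₀ - k t₀‖ ^ 2 / 4))⁻¹ * ⟪k t₀, c'⟫ / ‖c t₀ - k t₀‖) t₀ := by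
  have hd := (hc.sub hk).norm_of_ne_zero (norm_pos_iff.mp h0)
  have hcc := hc.inner_eq_zero_of_norm_eventually_eq hnorm
  have hinner : ⟪c t₀ - k t₀, c' - k'⟫ = -⟪k t₀, c'⟫ := by
    rw [inner_sub_right, horth, inner_sub_left, hcc]
    ring
  simp only [Pi.sub_apply, hinner] at hd
  have harcsin := Real.hasDerivAt_arcsin (x := ‖c t₀ - k t₀‖ / 2) (by linarith) (by linarith)
  refine ((harcsin.comp t₀ (hd.div_const 2)).const_mul 2).congr_deriv ?_
  rw [div_pow]
  norm_num
  ring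
end

section
/- Let E be a real inner product space, let t₀ ∈ ℝ, and let γ, k : ℝ → E be curves such that on a neighborhood J of t₀: ‖γ(t)‖ = 1, γ is twice differentiable with γ''(t) = -‖γ'(t)‖²·γ(t), k is differentiable with ⟨γ(t) - k(t), k'(t)⟩ = 0, and 0 < ‖γ(t) - k(t)‖ < 2. Write a = ‖γ(t₀) - k(t₀)‖. Then the function t ↦ 2·arcsin(‖γ(t) - k(t)‖/2) is twice differentiable at t₀ and its second derivative at t₀ equals (1/a)·(1 - a²/4)^(-1/2) · [ (1/4)·⟨k(t₀), γ'(t₀)⟩²·(1 - a²/4)⁻¹ - ( ⟨k'(t₀), γ'(t₀)⟩ - ‖γ'(t₀)‖²·⟨k(t₀), γ(t₀)⟩ + ⟨k(t₀), γ'(t₀)⟩²/a² ) ]. -/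
open scoped RealInnerProductSpace

section SphericalDistance

variable {E : Type*} [NormedAddCommGroup E] [InnerProductSpace ℝ E]

lemma inner_deriv_eq_zero_of_eventually_norm_eq_one {γ : ℝ → E} {t : ℝ}
    (h : ∀ᶠ s in nhds t, ‖γ s‖ = 1) (hγ : DifferentiableAt ℝ γ t) :
    ⟪γ t, deriv γ t⟫ = 0 := by
  have h₁ := hγ.hasDerivAt.norm_sq
  have h₂ : HasDerivAt (fun s => ‖γ s‖ ^ 2) 0 t :=
    (hasDerivAt_const t (1 : ℝ)).congr_of_eventuallyEq (h.mono fun s hs => by simp [hs])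
  linarith [h₁.unique h₂]

/-- Derivative of the chordal distance to a curve of closest points. -/
lemma hasDerivAt_norm_sub_of_inner_eq_zero {γ k : ℝ → E} {t : ℝ}
    (hγ : DifferentiableAt ℝ γ t) (hk : DifferentiableAt ℝ k t)
    (hγγ : ⟪γ t, deriv γ t⟫ = 0) (hγk : ⟪γ t - k t, deriv k t⟫ = 0)
    (hpos : 0 < ‖γ t - k t‖) :
    HasDerivAt (fun s => ‖γ s - k s‖) (-⟪k t, deriv γ t⟫ / ‖γ t - k t‖) t := by
  have h := (hγ.hasDerivAt.sub hk.hasDerivAt).norm_sq.sqrt (pow_pos hpos 2).ne'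
  simp only [Pi.sub_apply, Real.sqrt_sq (norm_nonneg _)] at h
  convert h using 1
  rw [inner_sub_right, hγk, inner_sub_left, hγγ]
  field_simp
  ring

lemma HasDerivAt.sqrt_one_sub_sq_div_four {f : ℝ → ℝ} {f' t : ℝ} (hf : HasDerivAt f f' t)
    (hpos : 0 < 1 - f t ^ 2 / 4) :
    HasDerivAt (fun s => √(1 - f s ^ 2 / 4)) (-(f t * f') / (4 * √(1 - f t ^ 2 / 4))) t := by
  have h := (((hf.pow 2).div_const 4).const_sub 1).sqrt hpos.ne'
  simp only [Pi.pow_apply] at h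
  refine h.congr_deriv ?_
  have := (Real.sqrt_pos.2 hpos).ne'
  field_simp
  ring

lemma HasDerivAt.two_mul_arcsin_half {f : ℝ → ℝ} {f' t : ℝ} (hf : HasDerivAt f f' t)
    (hpos : 0 < f t) (hlt : f t < 2) :
    HasDerivAt (fun s => 2 * Real.arcsin (f s / 2)) (f' / √(1 - f t ^ 2 / 4)) t := by
  have h := ((Real.hasDerivAt_arcsin (x := f t / 2) (by linarith) (by linarith)).comp t
    (hf.div_const 2)).const_mul 2
  refine h.congr_deriv ?_
  rw [show (f t / 2) ^ 2 = f t ^ 2 / 4 by ring]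
  ring

end SphericalDistance

/-- Lemma 11 of the paper (second derivative of the spherical distance along a great-circle
geodesic `γ`, with `k` the curve of closest points): under the stated hypotheses on a
neighborhood of `t₀`, the function `t ↦ 2·arcsin(‖γ(t) - k(t)‖/2)` is twice differentiable
at `t₀` and its second derivative there is given by the displayed formula, with
`a = ‖γ(t₀) - k(t₀)‖`. -/
theorem second_deriv_spherical_distance {E : Type*} [NormedAddCommGroup E]
    [InnerProductSpace ℝ E] (t₀ : ℝ) (γ k : ℝ → E)
    (h : ∀ᶠ t in nhds t₀,
      ‖γ t‖ = 1 ∧ DifferentiableAt ℝ γ t ∧ DifferentiableAt ℝ (deriv γ) t ∧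
      deriv (deriv γ) t = -(‖deriv γ t‖ ^ 2) • γ t ∧
      DifferentiableAt ℝ k t ∧ ⟪γ t - k t, deriv k t⟫ = 0 ∧
      0 < ‖γ t - k t‖ ∧ ‖γ t - k t‖ < 2) :
    DifferentiableAt ℝ (fun t => 2 * Real.arcsin (‖γ t - k t‖ / 2)) t₀ ∧
    DifferentiableAt ℝ (deriv fun t => 2 * Real.arcsin (‖γ t - k t‖ / 2)) t₀ ∧
    deriv (deriv fun t => 2 * Real.arcsin (‖γ t - k t‖ / 2)) t₀ =
      (1 / ‖γ t₀ - k t₀‖) * (Real.sqrt (1 - ‖γ t₀ - k t₀‖ ^ 2 / 4))⁻¹ *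
        (1 / 4 * ⟪k t₀, deriv γ t₀⟫ ^ 2 * (1 - ‖γ t₀ - k t₀‖ ^ 2 / 4)⁻¹ -
          (⟪deriv k t₀, deriv γ t₀⟫ - ‖deriv γ t₀‖ ^ 2 * ⟪k t₀, γ t₀⟫ +
            ⟪k t₀, deriv γ t₀⟫ ^ 2 / ‖γ t₀ - k t₀‖ ^ 2)) := by
  set ρ : ℝ → ℝ := fun t => 2 * Real.arcsin (‖γ t - k t‖ / 2)
  have hperp : ∀ᶠ t in nhds t₀, ⟪γ t, deriv γ t⟫ = 0 := by
    filter_upwards [h.eventually_nhds] with t ht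
    exact inner_deriv_eq_zero_of_eventually_norm_eq_one (ht.mono fun s hs => hs.1)
      ht.self_of_nhds.2.1
  have hfirst : ∀ᶠ t in nhds t₀, HasDerivAt ρ
      (-⟪k t, deriv γ t⟫ / ‖γ t - k t‖ / √(1 - ‖γ t - k t‖ ^ 2 / 4)) t := by
    filter_upwards [h, hperp] with t ⟨_, hγ, _, _, hk, hγk, hpos, hlt⟩ hγγ
    exact (hasDerivAt_norm_sub_of_inner_eq_zero hγ hk hγγ hγk hpos).two_mul_arcsin_half hpos hlt
  obtain ⟨_, hγ, hγ', hγ'', hk, hγk, hpos, hlt⟩ := h.self_of_nhds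
  have hnorm := hasDerivAt_norm_sub_of_inner_eq_zero hγ hk hperp.self_of_nhds hγk hpos
  have hrad : 0 < 1 - ‖γ t₀ - k t₀‖ ^ 2 / 4 := by nlinarith
  have hsqrt := hnorm.sqrt_one_sub_sq_div_four hrad
  have hinner : HasDerivAt (fun t => -⟪k t, deriv γ t⟫)
      (-(⟪deriv k t₀, deriv γ t₀⟫ - ‖deriv γ t₀‖ ^ 2 * ⟪k t₀, γ t₀⟫)) t₀ := by
    refine (hk.hasDerivAt.inner ℝ hγ'.hasDerivAt).neg.congr_deriv ?_
    rw [hγ'', inner_smul_right]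
    ring
  have hsqrt_pos := Real.sqrt_pos.2 hrad
  have hsecond := ((hinner.div hnorm hpos.ne').div hsqrt hsqrt_pos.ne').congr_of_eventuallyEq
    (hfirst.mono fun t ht => ht.deriv)
  refine ⟨hfirst.self_of_nhds.differentiableAt, hsecond.differentiableAt, ?_⟩
  rw [hsecond.deriv]
  have hsq : (1 - ‖γ t₀ - k t₀‖ ^ 2 / 4) = √(1 - ‖γ t₀ - k t₀‖ ^ 2 / 4) ^ 2 :=
    (Real.sq_sqrt hrad.le).symm
  rw [show (1 - ‖γ t₀ - k t₀‖ ^ 2 / 4)⁻¹ = (√(1 - ‖γ t₀ - k t₀‖ ^ 2 / 4) ^ 2)⁻¹ by rw [← hsq]]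
  simp only [Pi.div_apply]
  generalize √(1 - ‖γ t₀ - k t₀‖ ^ 2 / 4) = s at hsqrt_pos ⊢
  field_simp
  ring
end

section
/- Let E be a real inner product space and let x, k ∈ E with ‖x‖ = 1, ‖k‖ = 1 and ⟨k, x⟩² < 1. Then: (a) for every ẋ ∈ E with ‖ẋ‖ = 1 and ⟨x, ẋ⟩ = 0, one has (1 - ‖x - k‖²/4)⁻¹ · ⟨k, ẋ⟩² / ‖x - k‖² ≤ 1; and (b) the vector ẋ₀ = (k - ⟨k, x⟩·x)/√(1 - ⟨k, x⟩²) satisfies ‖ẋ₀‖ = 1, ⟨x, ẋ₀⟩ = 0, and (1 - ‖x - k‖²/4)⁻¹ · ⟨k, ẋ₀⟩² / ‖x - k‖² = 1. -/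
open scoped RealInnerProductSpace

/-- For unit vectors, `(1 - ‖x-k‖²/4)·‖x-k‖² = 1 - ⟨k,x⟩²`. -/
theorem one_sub_norm_sub_sq_div_four_mul {E : Type*} [NormedAddCommGroup E]
    [InnerProductSpace ℝ E] {x k : E} (hx : ‖x‖ = 1) (hk : ‖k‖ = 1) :
    (1 - ‖x - k‖ ^ 2 / 4) * ‖x - k‖ ^ 2 = 1 - ⟪k, x⟫ ^ 2 := by
  rw [norm_sub_sq_real, hx, hk, real_inner_comm]
  ring

/-- The squared norm of the tangential projection of `k` at the unit vector `x`. -/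
theorem norm_sub_inner_smul_sq {E : Type*} [NormedAddCommGroup E]
    [InnerProductSpace ℝ E] {x k : E} (hx : ‖x‖ = 1) (hk : ‖k‖ = 1) :
    ‖k - ⟪k, x⟫ • x‖ ^ 2 = 1 - ⟪k, x⟫ ^ 2 := by
  rw [norm_sub_sq_real, norm_smul, inner_smul_right, hx, hk, mul_one, Real.norm_eq_abs, sq_abs]
  ring

/-- Lemma 13 of the paper (`‖Dρ_x‖ = 1`): for unit vectors `x, k` with `⟨k,x⟩² < 1`,
(a) every unit tangent vector `ẋ` at `x` satisfies
`(1 - ‖x-k‖²/4)⁻¹·⟨k,ẋ⟩²/‖x-k‖² ≤ 1`, and (b) the normalized tangential projection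
`ẋ₀ = (k - ⟨k,x⟩x)/√(1 - ⟨k,x⟩²)` is a unit tangent vector attaining the value `1`. -/
theorem sphere_dist_grad_norm {E : Type*} [NormedAddCommGroup E]
    [InnerProductSpace ℝ E] (x k : E) (hx : ‖x‖ = 1) (hk : ‖k‖ = 1)
    (h : ⟪k, x⟫ ^ 2 < 1) :
    (∀ v : E, ‖v‖ = 1 → ⟪x, v⟫ = 0 →
      (1 - ‖x - k‖ ^ 2 / 4)⁻¹ * ⟪k, v⟫ ^ 2 / ‖x - k‖ ^ 2 ≤ 1) ∧
    ‖(Real.sqrt (1 - ⟪k, x⟫ ^ 2))⁻¹ • (k - ⟪k, x⟫ • x)‖ = 1 ∧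
    ⟪x, (Real.sqrt (1 - ⟪k, x⟫ ^ 2))⁻¹ • (k - ⟪k, x⟫ • x)⟫ = 0 ∧
    (1 - ‖x - k‖ ^ 2 / 4)⁻¹ *
        ⟪k, (Real.sqrt (1 - ⟪k, x⟫ ^ 2))⁻¹ • (k - ⟪k, x⟫ • x)⟫ ^ 2 / ‖x - k‖ ^ 2 = 1 := by
  have hpos : 0 < 1 - ⟪k, x⟫ ^ 2 := sub_pos.mpr h
  have hsqrt : 0 < Real.sqrt (1 - ⟪k, x⟫ ^ 2) := Real.sqrt_pos.mpr hpos
  have hsq : Real.sqrt (1 - ⟪k, x⟫ ^ 2) ^ 2 = 1 - ⟪k, x⟫ ^ 2 := Real.sq_sqrt hpos.le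
  have hproj := norm_sub_inner_smul_sq hx hk
  have hform (a : ℝ) :
      (1 - ‖x - k‖ ^ 2 / 4)⁻¹ * a / ‖x - k‖ ^ 2 = a / (1 - ⟪k, x⟫ ^ 2) := by
    rw [← one_sub_norm_sub_sq_div_four_mul hx hk, inv_mul_eq_div, div_div]
  refine ⟨fun v hv hxv => ?_, ?_, ?_, ?_⟩
  · rw [hform, div_le_one hpos, ← hproj]
    have hinner : ⟪k, v⟫ = ⟪k - ⟪k, x⟫ • x, v⟫ := by
      rw [inner_sub_left, real_inner_smul_left, hxv, mul_zero, sub_zero]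
    rw [hinner, sq_le_sq, abs_norm]
    simpa [hv] using abs_real_inner_le_norm (k - ⟪k, x⟫ • x) v
  · rw [norm_smul, norm_inv, Real.norm_of_nonneg hsqrt.le, ← hproj,
      Real.sqrt_sq (norm_nonneg _)]
    refine inv_mul_cancel₀ fun h0 => ?_
    rw [h0] at hproj
    linarith
  · rw [inner_smul_right, inner_sub_right, inner_smul_right, real_inner_self_eq_norm_sq, hx,
      real_inner_comm]
    ring
  · have hinner : ⟪k, k - ⟪k, x⟫ • x⟫ = 1 - ⟪k, x⟫ ^ 2 := by
      rw [inner_sub_right, inner_smul_right, real_inner_self_eq_norm_sq, hk]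
      ring
    rw [hform, inner_smul_right, hinner, mul_pow, inv_pow, hsq]
    field_simp
end

section
/- Define f : ℝ² \ {0} → ℝ³ by f(p) = (p₁/‖p‖, p₂/‖p‖, log ‖p‖), where ‖·‖ is the Euclidean norm. Then f is differentiable at every p ≠ 0 and for every v ∈ ℝ², ‖Df_p(v)‖ = ‖v‖/‖p‖. -/
/-- The map `f(p) = (p₁/‖p‖, p₂/‖p‖, log ‖p‖)` from `ℝ² \ {0}` to `ℝ³` of Example 2. -/
noncomputable def cylinderMap (q : EuclideanSpace ℝ (Fin 2)) : EuclideanSpace ℝ (Fin 3) :=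
  (WithLp.equiv 2 (Fin 3 → ℝ)).symm ![q 0 / ‖q‖, q 1 / ‖q‖, Real.log ‖q‖]

theorem hasFDerivAt_norm_of_ne_zero {E : Type*} [NormedAddCommGroup E] [InnerProductSpace ℝ E]
    {p : E} (hp : p ≠ 0) :
    HasFDerivAt (fun q : E => ‖q‖) (‖p‖⁻¹ • innerSL ℝ p) p := by
  have hn : ‖p‖ ≠ 0 := norm_ne_zero_iff.mpr hp
  have h := (hasStrictFDerivAt_norm_sq p).hasFDerivAt.sqrt (pow_ne_zero 2 hn)
  simp only [Real.sqrt_sq (norm_nonneg _)] at h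
  refine h.congr_fderiv ?_
  ext v
  simp
  field_simp

theorem EuclideanSpace.hasFDerivAt_coord {ι : Type*} [Fintype ι] (i : ι)
    (p : EuclideanSpace ℝ ι) :
    HasFDerivAt (fun q : EuclideanSpace ℝ ι => q i) (EuclideanSpace.proj (𝕜 := ℝ) i) p :=
  (EuclideanSpace.proj (𝕜 := ℝ) i : EuclideanSpace ℝ ι →L[ℝ] ℝ).hasFDerivAt

theorem EuclideanSpace.hasFDerivAt_coord_div_norm {ι : Type*} [Fintype ι] (i : ι)
    {p : EuclideanSpace ℝ ι} (hp : p ≠ 0) :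
    HasFDerivAt (fun q : EuclideanSpace ℝ ι => q i / ‖q‖)
      (‖p‖⁻¹ • (EuclideanSpace.proj (𝕜 := ℝ) i : EuclideanSpace ℝ ι →L[ℝ] ℝ)
        - (p i / ‖p‖ ^ 3) • innerSL ℝ p) p := by
  have hn : ‖p‖ ≠ 0 := norm_ne_zero_iff.mpr hp
  refine ((EuclideanSpace.hasFDerivAt_coord i p).mul
    ((hasDerivAt_inv hn).comp_hasFDerivAt p (hasFDerivAt_norm_of_ne_zero hp))).congr_fderiv ?_
  ext v
  simp
  field_simp
  ring

/-- Example 2 of the paper: the map `f(p) = (p₁/‖p‖, p₂/‖p‖, log ‖p‖)` is differentiable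
at every `p ≠ 0` and satisfies `‖Df_p(v)‖ = ‖v‖/‖p‖`, i.e. it pulls back the Euclidean
metric of `ℝ³` to the condition metric `‖p‖⁻²·⟨·,·⟩` on `ℝ² \ {0}`. -/
theorem cylinderMap_isometry (p : EuclideanSpace ℝ (Fin 2)) (hp : p ≠ 0) :
    DifferentiableAt ℝ cylinderMap p ∧
    ∀ v : EuclideanSpace ℝ (Fin 2), ‖fderiv ℝ cylinderMap p v‖ = ‖v‖ / ‖p‖ := by
  have hn : ‖p‖ ≠ 0 := norm_ne_zero_iff.mpr hp
  have h0 : HasFDerivAt (fun q => cylinderMap q 0) _ p :=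
    EuclideanSpace.hasFDerivAt_coord_div_norm 0 hp
  have h1 : HasFDerivAt (fun q => cylinderMap q 1) _ p :=
    EuclideanSpace.hasFDerivAt_coord_div_norm 1 hp
  have h2 : HasFDerivAt (fun q => cylinderMap q 2) _ p :=
    (hasFDerivAt_norm_of_ne_zero hp).log hn
  have hd : DifferentiableAt ℝ cylinderMap p := by
    rw [differentiableAt_euclidean]
    intro i
    fin_cases i
    exacts [h0.differentiableAt, h1.differentiableAt, h2.differentiableAt]
  refine ⟨hd, fun v => ?_⟩
  have hc (i : Fin 3) :=
    (EuclideanSpace.hasFDerivAt_coord i (cylinderMap p)).comp p hd.hasFDerivAt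
  have e0 := DFunLike.congr_fun ((hc 0).unique h0) v
  have e1 := DFunLike.congr_fun ((hc 1).unique h1) v
  have e2 := DFunLike.congr_fun ((hc 2).unique h2) v
  simp [PiLp.inner_apply, Fin.sum_univ_two] at e0 e1 e2
  have hp2 := EuclideanSpace.real_norm_sq_eq p
  have hv2 := EuclideanSpace.real_norm_sq_eq v
  rw [Fin.sum_univ_two] at hp2 hv2
  rw [← sq_eq_sq₀ (norm_nonneg _) (by positivity), EuclideanSpace.real_norm_sq_eq,
    Fin.sum_univ_three, e0, e1, e2, div_pow, hv2]
  field_simp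
  linear_combination (-(v 0 * p 0 + v 1 * p 1) ^ 2) * hp2
end

section
/- Let I ⊆ ℝ be an open interval and let r, φ : I → ℝ be twice differentiable functions with r(t) ∈ (0,1) for all t ∈ I, satisfying the geodesic equation r''(t) + r'(t)²/(1 - r(t)) - r(t)·φ'(t)²/(1 - r(t)) = 0 for all t ∈ I. Then for every t ∈ I the function t ↦ -log(1 - r(t)) is twice differentiable with second derivative equal to r(t)·φ'(t)²/(1 - r(t))². In particular, t ↦ -log(1 - r(t)) is convex on I. -/
/-- First derivative of `-log (1 - r)` at a point where `r ≠ 1`. -/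
lemma hasDerivAt_neg_log_one_sub {r : ℝ → ℝ} {t r' : ℝ} (hr : HasDerivAt r r' t)
    (ht : 1 - r t ≠ 0) :
    HasDerivAt (fun s => -Real.log (1 - r s)) (r' / (1 - r t)) t :=
  ((hr.const_sub 1).log ht).neg.congr_deriv (by ring)

/-- Second derivative of `-log (1 - r)`: the derivative has derivative
`r'' / (1 - r) + r' ^ 2 / (1 - r) ^ 2`. -/
lemma hasDerivAt_deriv_neg_log_one_sub {r : ℝ → ℝ} {t : ℝ}
    (hr : ∀ᶠ s in nhds t, DifferentiableAt ℝ r s ∧ 1 - r s ≠ 0)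
    (hr' : DifferentiableAt ℝ (deriv r) t) :
    HasDerivAt (deriv fun s => -Real.log (1 - r s))
      (deriv (deriv r) t / (1 - r t) + deriv r t ^ 2 / (1 - r t) ^ 2) t := by
  obtain ⟨hrt, ht⟩ := hr.self_of_nhds
  have hderiv : (deriv fun s => -Real.log (1 - r s)) =ᶠ[nhds t]
      fun s => deriv r s / (1 - r s) :=
    hr.mono fun s hs => (hasDerivAt_neg_log_one_sub hs.1.hasDerivAt hs.2).deriv
  refine HasDerivAt.congr_of_eventuallyEq ?_ hderiv
  refine (hr'.hasDerivAt.div (hrt.hasDerivAt.const_sub 1) ht).congr_deriv ?_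
  field_simp
  ring

/-- The second-derivative computation in the disk model of the punctured hyperbolic plane:
if `r, φ` are twice differentiable with `r(t) ∈ (0,1)` and satisfy the geodesic equation
`r'' + r'²/(1-r) - r·φ'²/(1-r) = 0`, then `t ↦ -log(1 - r(t))` is twice differentiable
with second derivative `r·φ'²/(1-r)²`; in particular it is convex. -/
theorem hyperbolic_distance_convex (a b : ℝ) (r φ : ℝ → ℝ)
    (hr : ∀ t ∈ Set.Ioo a b, DifferentiableAt ℝ r t)
    (hr' : ∀ t ∈ Set.Ioo a b, DifferentiableAt ℝ (deriv r) t)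
    (hφ : ∀ t ∈ Set.Ioo a b, DifferentiableAt ℝ φ t)
    (hφ' : ∀ t ∈ Set.Ioo a b, DifferentiableAt ℝ (deriv φ) t)
    (hr01 : ∀ t ∈ Set.Ioo a b, r t ∈ Set.Ioo (0 : ℝ) 1)
    (hgeo : ∀ t ∈ Set.Ioo a b,
      deriv (deriv r) t + (deriv r t) ^ 2 / (1 - r t)
        - r t * (deriv φ t) ^ 2 / (1 - r t) = 0) :
    (∀ t ∈ Set.Ioo a b,
      DifferentiableAt ℝ (fun s => -Real.log (1 - r s)) t ∧
      DifferentiableAt ℝ (deriv fun s => -Real.log (1 - r s)) t ∧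
      deriv (deriv fun s => -Real.log (1 - r s)) t
        = r t * (deriv φ t) ^ 2 / (1 - r t) ^ 2) ∧
    ConvexOn ℝ (Set.Ioo a b) (fun t => -Real.log (1 - r t)) := by
  have hne : ∀ t ∈ Set.Ioo a b, 1 - r t ≠ 0 := fun t ht => (sub_pos.2 (hr01 t ht).2).ne'
  have hfst : ∀ t ∈ Set.Ioo a b, DifferentiableAt ℝ (fun s => -Real.log (1 - r s)) t :=
    fun t ht =>
      (hasDerivAt_neg_log_one_sub (hr t ht).hasDerivAt (hne t ht)).differentiableAt
  have hsnd : ∀ t ∈ Set.Ioo a b, HasDerivAt (deriv fun s => -Real.log (1 - r s))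
      (r t * (deriv φ t) ^ 2 / (1 - r t) ^ 2) t := by
    intro t ht
    have hnhds : ∀ᶠ s in nhds t, DifferentiableAt ℝ r s ∧ 1 - r s ≠ 0 :=
      (isOpen_Ioo.eventually_mem ht).mono fun s hs => ⟨hr s hs, hne s hs⟩
    convert hasDerivAt_deriv_neg_log_one_sub hnhds (hr' t ht) using 1
    have h : deriv (deriv r) t
        = r t * (deriv φ t) ^ 2 / (1 - r t) - (deriv r t) ^ 2 / (1 - r t) := by
      linarith [hgeo t ht]
    have := hne t ht
    rw [h]
    field_simp
    ring
  refine ⟨fun t ht => ⟨hfst t ht, (hsnd t ht).differentiableAt, (hsnd t ht).deriv⟩, ?_⟩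
  refine convexOn_of_deriv2_nonneg' (convex_Ioo a b)
    (fun t ht => (hfst t ht).differentiableWithinAt)
    (fun t ht => (hsnd t ht).differentiableAt.differentiableWithinAt) fun t ht => ?_
  have hpos := (hr01 t ht).1
  rw [Function.iterate_succ_apply, Function.iterate_one, (hsnd t ht).deriv]
  positivity
end
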